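/- arXiv:1603.06547 — 8 statements merged into one kernel-verified Lean document; each statement's English description precedes it below -/
import Mathlib

section
/- Every bounded lattice A has a canonical extension: there exist a complete lattice C and an injective bounded lattice homomorphism e : A → C (preserving binary meets and joins, ⊥ and ⊤) whose image e(A) is dense and compact in C. -/
/-- `A` is a bounded sublattice of the complete lattice `C`: it is closed under binary
meets and joins and contains `⊥` and `⊤`. -/
def IsBddSublattice {C : Type*} [CompleteLattice C] (A : Set C) : Prop :=
  (∀ a ∈ A, ∀ b ∈ A, a ⊓ b ∈ A) ∧ (∀ a ∈ A, ∀ b ∈ A, a ⊔ b ∈ A) ∧ ⊥ ∈ A ∧ ⊤ ∈ A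

/-- `A` is dense in `C`: every element of `C` is both a join of meets and a meet of
joins of elements of `A`. -/
def IsDenseIn {C : Type*} [CompleteLattice C] (A : Set C) : Prop :=
  ∀ u : C,
    (∃ 𝒮 : Set (Set C), (∀ S ∈ 𝒮, S ⊆ A) ∧ u = sSup (sInf '' 𝒮)) ∧
    (∃ 𝒯 : Set (Set C), (∀ T ∈ 𝒯, T ⊆ A) ∧ u = sInf (sSup '' 𝒯))

/-- `A` is compact in `C`: whenever a meet of elements of `A` lies below a join of
elements of `A`, some finite sub-meet lies below some finite sub-join. -/
def IsCompactIn {C : Type*} [CompleteLattice C] (A : Set C) : Prop :=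
  ∀ S T : Set C, S ⊆ A → T ⊆ A → sInf S ≤ sSup T →
    ∃ S' T' : Finset C, ↑S' ⊆ S ∧ ↑T' ⊆ T ∧ sInf (S' : Set C) ≤ sSup (T' : Set C)


/-- `e : A → C` realizes the complete lattice `C` as a canonical extension of the
bounded lattice `A`: `e` is an injective bounded-lattice homomorphism whose image
is dense and compact in `C`. -/
structure IsCanonicalExtension (A : Type*) [Lattice A] [BoundedOrder A]
    (C : Type*) [CompleteLattice C] (e : A → C) : Prop where
  inj : Function.Injective e
  map_inf : ∀ a b : A, e (a ⊓ b) = e a ⊓ e b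
  map_sup : ∀ a b : A, e (a ⊔ b) = e a ⊔ e b
  map_bot : e ⊥ = ⊥
  map_top : e ⊤ = ⊤
  dense : IsDenseIn (Set.range e)
  compact : IsCompactIn (Set.range e)

open Order

/-- The relation between filters and ideals of meeting in a common element. -/
def FilterMeetsIdeal (A : Type*) [Preorder A] (F : PFilter A) (I : Ideal A) : Prop :=
  ∃ a, a ∈ F ∧ a ∈ I

/-- The concept of the relation `FilterMeetsIdeal` determined by an element: the filters
containing it together with the ideals containing it. -/
def elementConcept {A : Type*} [Preorder A] (a : A) :
    Concept (PFilter A) (Ideal A) (FilterMeetsIdeal A) where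
  extent := {F | a ∈ F}
  intent := {I | a ∈ I}
  upperPolar_extent := by
    ext I
    refine ⟨fun h => ?_, fun ha F hF => ⟨a, hF, ha⟩⟩
    obtain ⟨x, hx, hxI⟩ := @h (PFilter.principal a) (PFilter.mem_principal.2 le_rfl)
    exact I.lower (PFilter.mem_principal.1 hx) hxI
  lowerPolar_intent := by
    ext F
    refine ⟨fun h => ?_, fun ha I hI => ⟨a, ha, hI⟩⟩
    obtain ⟨x, hx, hxI⟩ := @h (Ideal.principal a) (Ideal.mem_principal.2 le_rfl)
    exact PFilter.mem_of_le (Ideal.mem_principal.1 hxI) hx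

/-- The ideal generated by a set, described through finite joins. -/
def Order.Ideal.ofFinsetSup {A : Type*} [SemilatticeSup A] [OrderBot A] (s : Set A) : Ideal A where
  carrier := {x | ∃ f : Finset A, ↑f ⊆ s ∧ x ≤ f.sup id}
  lower' := fun _ _ hyx ⟨f, hf, hx⟩ => ⟨f, hf, hyx.trans hx⟩
  nonempty' := ⟨⊥, ∅, by simp, bot_le⟩
  directed' := by
    classical
    rintro x ⟨f, hf, hx⟩ y ⟨g, hg, hy⟩
    refine ⟨x ⊔ y, ⟨f ∪ g, by simp [hf, hg], ?_⟩, le_sup_left, le_sup_right⟩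
    rw [Finset.sup_union]
    exact sup_le_sup hx hy

theorem Order.Ideal.mem_ofFinsetSup {A : Type*} [SemilatticeSup A] [OrderBot A] {s : Set A}
    {x : A} : x ∈ Ideal.ofFinsetSup s ↔ ∃ f : Finset A, ↑f ⊆ s ∧ x ≤ f.sup id := Iff.rfl

theorem Order.Ideal.subset_ofFinsetSup {A : Type*} [SemilatticeSup A] [OrderBot A] (s : Set A) :
    s ⊆ Ideal.ofFinsetSup s :=
  fun x hx => ⟨{x}, by simpa using hx, by simp⟩

/-- The filter generated by a set, described through finite meets. -/
def Order.PFilter.ofFinsetInf {A : Type*} [SemilatticeInf A] [OrderTop A] (s : Set A) : PFilter A :=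
  ⟨Ideal.ofFinsetSup (A := Aᵒᵈ) (OrderDual.ofDual ⁻¹' s)⟩

theorem Order.PFilter.mem_ofFinsetInf {A : Type*} [SemilatticeInf A] [OrderTop A] {s : Set A}
    {x : A} : x ∈ PFilter.ofFinsetInf s ↔ ∃ f : Finset A, ↑f ⊆ s ∧ f.inf id ≤ x := Iff.rfl

theorem Order.PFilter.subset_ofFinsetInf {A : Type*} [SemilatticeInf A] [OrderTop A] (s : Set A) :
    s ⊆ PFilter.ofFinsetInf s :=
  fun x hx => PFilter.mem_ofFinsetInf.2 ⟨{x}, by simpa using hx, by simp⟩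

section Preorder

variable {A : Type*} [Preorder A]

theorem mem_extent_sInf_elementConcept {s : Set A} {F : PFilter A} :
    F ∈ (sInf (elementConcept '' s)).extent ↔ s ⊆ F := by
  simp [sInf_image, Concept.extent_iInf, elementConcept, Set.subset_def]

theorem mem_intent_sSup_elementConcept {s : Set A} {I : Ideal A} :
    I ∈ (sSup (elementConcept '' s)).intent ↔ s ⊆ I := by
  simp [sSup_image, Concept.intent_iSup, elementConcept, Set.subset_def]

variable (u : Concept (PFilter A) (Ideal A) (FilterMeetsIdeal A))

theorem eq_sSup_sInf_elementConcept :
    u = sSup (sInf '' ((fun F : PFilter A => elementConcept '' (F : Set A)) '' u.extent)) := by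
  apply le_antisymm
  · intro F hF
    refine Concept.extent_subset_extent_iff.2
      (le_sSup (Set.mem_image_of_mem _ (Set.mem_image_of_mem _ hF))) ?_
    exact mem_extent_sInf_elementConcept.2 subset_rfl
  · refine sSup_le ?_
    rintro _ ⟨_, ⟨F, hF, rfl⟩, rfl⟩ G hG
    rw [← u.lowerPolar_intent]
    intro I hI
    obtain ⟨a, haF, haI⟩ := u.rel_extent_intent hF hI
    exact ⟨a, mem_extent_sInf_elementConcept.1 hG haF, haI⟩

theorem eq_sInf_sSup_elementConcept :
    u = sInf (sSup '' ((fun I : Ideal A => elementConcept '' (I : Set A)) '' u.intent)) := by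
  apply le_antisymm
  · refine le_sInf ?_
    rintro _ ⟨_, ⟨I, hI, rfl⟩, rfl⟩
    rw [← Concept.intent_subset_intent_iff]
    intro J hJ
    rw [← u.upperPolar_extent]
    intro F hF
    obtain ⟨a, haF, haI⟩ := u.rel_extent_intent hF hI
    exact ⟨a, haF, mem_intent_sSup_elementConcept.1 hJ haI⟩
  · rw [← Concept.intent_subset_intent_iff]
    intro I hI
    refine Concept.intent_subset_intent_iff.2
      (sInf_le (Set.mem_image_of_mem _ (Set.mem_image_of_mem _ hI))) ?_
    exact mem_intent_sSup_elementConcept.2 subset_rfl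

theorem isDenseIn_range_elementConcept : IsDenseIn (Set.range (elementConcept (A := A))) :=
  fun u => ⟨⟨_, by simp, eq_sSup_sInf_elementConcept u⟩,
    ⟨_, by simp, eq_sInf_sSup_elementConcept u⟩⟩

theorem elementConcept_mono : Monotone (elementConcept (A := A)) :=
  fun _ _ hab _ hF => PFilter.mem_of_le hab hF

end Preorder

theorem elementConcept_injective {A : Type*} [PartialOrder A] :
    Function.Injective (elementConcept (A := A)) := by
  intro a b h
  have hmem (F : PFilter A) : a ∈ F ↔ b ∈ F := Set.ext_iff.1 (congrArg Concept.extent h) F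
  exact le_antisymm
    (PFilter.mem_principal.1 ((hmem (PFilter.principal a)).1 (PFilter.mem_principal.2 le_rfl)))
    (PFilter.mem_principal.1 ((hmem (PFilter.principal b)).2 (PFilter.mem_principal.2 le_rfl)))

theorem elementConcept_inf {A : Type*} [SemilatticeInf A] (a b : A) :
    elementConcept (a ⊓ b) = elementConcept a ⊓ elementConcept b :=
  Concept.ext (Set.ext fun _ => PFilter.inf_mem_iff)

theorem elementConcept_sup {A : Type*} [SemilatticeSup A] (a b : A) :
    elementConcept (a ⊔ b) = elementConcept a ⊔ elementConcept b :=
  Concept.ext' (Set.ext fun _ => Ideal.sup_mem_iff)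

theorem elementConcept_bot {A : Type*} [Preorder A] [OrderBot A] :
    elementConcept (⊥ : A) = ⊥ :=
  Concept.ext' (Set.eq_univ_of_forall fun I => I.bot_mem)

theorem elementConcept_top {A : Type*} [Preorder A] [OrderTop A] :
    elementConcept (⊤ : A) = ⊤ :=
  Concept.ext (Set.eq_univ_of_forall fun _ => PFilter.top_mem)

theorem isCompactIn_range_elementConcept {A : Type*} [Lattice A] [BoundedOrder A] :
    IsCompactIn (Set.range (elementConcept (A := A))) := by
  classical
  intro S T hS hT hST
  obtain ⟨s, rfl⟩ := Set.subset_range_iff_exists_image_eq.1 hS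
  obtain ⟨t, rfl⟩ := Set.subset_range_iff_exists_image_eq.1 hT
  obtain ⟨a, haF, haI⟩ := Concept.rel_extent_intent
    (hST (mem_extent_sInf_elementConcept.2 (PFilter.subset_ofFinsetInf s)))
    (mem_intent_sSup_elementConcept.2 (Ideal.subset_ofFinsetSup t))
  obtain ⟨f, hf, hfa⟩ := PFilter.mem_ofFinsetInf.1 haF
  obtain ⟨g, hg, hag⟩ := Ideal.mem_ofFinsetSup.1 haI
  refine ⟨f.image elementConcept, g.image elementConcept, ?_, ?_, ?_⟩
  · simpa using Set.image_mono hf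
  · simpa using Set.image_mono hg
  · have h := elementConcept_mono (hfa.trans hag)
    rw [Finset.apply_inf_eq_inf_comp _ elementConcept_inf elementConcept_top,
      Finset.apply_sup_eq_sup_comp _ elementConcept_sup elementConcept_bot] at h
    simpa [Finset.inf_eq_sInf_image, Finset.sup_eq_sSup_image] using h

/-- Every bounded lattice has a canonical extension. -/
theorem canonical_extension_exists (A : Type u) [Lattice A] [BoundedOrder A] :
    ∃ (C : Type u) (instC : CompleteLattice C) (e : A → C),
      @IsCanonicalExtension A _ _ C instC e :=
  ⟨Concept (PFilter A) (Ideal A) (FilterMeetsIdeal A), inferInstance, elementConcept,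
    elementConcept_injective, elementConcept_inf, elementConcept_sup, elementConcept_bot,
    elementConcept_top, isDenseIn_range_elementConcept, isCompactIn_range_elementConcept⟩
end

section
/- The canonical extension is unique up to isomorphism fixing A: if e₁ : A → C₁ and e₂ : A → C₂ are injective bounded lattice homomorphisms of a bounded lattice A into complete lattices C₁, C₂ such that the images e₁(A) and e₂(A) are dense and compact, then there exists an order isomorphism φ : C₁ ≃o C₂ with φ ∘ e₁ = e₂. -/
/-- In a compact lattice embedding, a comparison of a meet with a join of embedded elements
is witnessed by finitely many elements of the embedded lattice. -/
theorem IsCompactIn.exists_finset_inf_le_sup {A C : Type*} [Lattice A] [BoundedOrder A]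
    [CompleteLattice C] (e : BoundedLatticeHom A C) (hinj : Function.Injective e)
    (hc : IsCompactIn (Set.range e)) {S T : Set A} (h : sInf (e '' S) ≤ sSup (e '' T)) :
    ∃ s t : Finset A, ↑s ⊆ S ∧ ↑t ⊆ T ∧ s.inf id ≤ t.sup id := by
  classical
  obtain ⟨S', T', hS, hT, hle⟩ :=
    hc _ _ (Set.image_subset_range e S) (Set.image_subset_range e T) h
  obtain ⟨s, hs, rfl⟩ := Finset.subset_set_image_iff.1 hS
  obtain ⟨t, ht, rfl⟩ := Finset.subset_set_image_iff.1 hT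
  refine ⟨s, t, hs, ht, ?_⟩
  have hle' : e (s.inf id) ≤ e (t.sup id) := by
    rw [map_finset_inf, map_finset_sup]
    simpa [Finset.inf_eq_iInf, Finset.sup_eq_iSup, sInf_image, sSup_image] using hle
  rw [← inf_eq_left] at hle' ⊢
  exact hinj (by rw [map_inf, hle'])

/-- Comparisons of meets with joins of embedded elements transfer from a compact lattice
embedding to any other bounded lattice homomorphism. -/
theorem IsCompactIn.sInf_image_le_sSup_image {A C D : Type*} [Lattice A] [BoundedOrder A]
    [CompleteLattice C] [CompleteLattice D] (e : BoundedLatticeHom A C)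
    (f : BoundedLatticeHom A D) (hinj : Function.Injective e)
    (hc : IsCompactIn (Set.range e)) {S T : Set A} (h : sInf (e '' S) ≤ sSup (e '' T)) :
    sInf (f '' S) ≤ sSup (f '' T) := by
  obtain ⟨s, t, hs, ht, hle⟩ := hc.exists_finset_inf_le_sup e hinj h
  calc sInf (f '' S) ≤ s.inf f :=
        Finset.le_inf fun a ha => sInf_le (Set.mem_image_of_mem f (hs ha))
    _ = f (s.inf id) := by rw [map_finset_inf]; rfl
    _ ≤ f (t.sup id) := OrderHomClass.mono f hle
    _ = t.sup f := by rw [map_finset_sup]; rfl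
    _ ≤ sSup (f '' T) :=
        Finset.sup_le fun a ha => le_sSup (Set.mem_image_of_mem f (ht ha))

/-- The map sending `u` to the join of the images under `f` of the meets of embedded elements
below `u`. -/
def denseExtension {A C D : Type*} [CompleteLattice C] [CompleteLattice D]
    (e : A → C) (f : A → D) (u : C) : D :=
  ⨆ (S : Set A) (_ : sInf (e '' S) ≤ u), sInf (f '' S)

theorem denseExtension_mono {A C D : Type*} [CompleteLattice C] [CompleteLattice D]
    (e : A → C) (f : A → D) : Monotone (denseExtension e f) :=
  fun _ _ h => iSup₂_le fun S hS => le_iSup₂_of_le S (hS.trans h) le_rfl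

theorem IsDenseIn.denseExtension_self {A C : Type*} [CompleteLattice C] {e : A → C}
    (hd : IsDenseIn (Set.range e)) (u : C) : denseExtension e e u = u := by
  refine le_antisymm (iSup₂_le fun _ hS => hS) ?_
  obtain ⟨𝒮, h𝒮, hu⟩ := (hd u).1
  conv_lhs => rw [hu]
  refine sSup_le ?_
  rintro _ ⟨S, hS, rfl⟩
  obtain ⟨S₀, rfl⟩ := Set.subset_range_iff_exists_image_eq.1 (h𝒮 S hS)
  refine le_iSup₂_of_le S₀ ?_ le_rfl
  rw [hu]
  exact le_sSup (Set.mem_image_of_mem _ hS)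

theorem IsDenseIn.le_of_forall_le_sSup {A C : Type*} [CompleteLattice C] {e : A → C}
    (hd : IsDenseIn (Set.range e)) {u v : C}
    (h : ∀ T : Set A, u ≤ sSup (e '' T) → v ≤ sSup (e '' T)) : v ≤ u := by
  obtain ⟨𝒯, h𝒯, hu⟩ := (hd u).2
  conv_rhs => rw [hu]
  refine le_sInf ?_
  rintro _ ⟨T, hT, rfl⟩
  obtain ⟨T₀, rfl⟩ := Set.subset_range_iff_exists_image_eq.1 (h𝒯 T hT)
  refine h T₀ ?_
  rw [hu]
  exact sInf_le (Set.mem_image_of_mem _ hT)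

section

variable {A C D : Type*} [Lattice A] [BoundedOrder A] [CompleteLattice C] [CompleteLattice D]
  (e : BoundedLatticeHom A C) (f : BoundedLatticeHom A D)

theorem denseExtension_le_sSup_image (he : Function.Injective e)
    (hec : IsCompactIn (Set.range e)) {u : C} {T : Set A} (h : u ≤ sSup (e '' T)) :
    denseExtension e f u ≤ sSup (f '' T) :=
  iSup₂_le fun _ hS => hec.sInf_image_le_sSup_image e f he (hS.trans h)

theorem sInf_image_le_denseExtension_iff (he : Function.Injective e)
    (hf : Function.Injective f) (hed : IsDenseIn (Set.range e))
    (hec : IsCompactIn (Set.range e)) (hfc : IsCompactIn (Set.range f)) {u : C} {S : Set A} :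
    sInf (f '' S) ≤ denseExtension e f u ↔ sInf (e '' S) ≤ u := by
  refine ⟨fun h => hed.le_of_forall_le_sSup fun T hT => ?_, fun h => le_iSup₂_of_le S h le_rfl⟩
  exact hfc.sInf_image_le_sSup_image f e hf
    (h.trans (denseExtension_le_sSup_image e f he hec hT))

theorem denseExtension_denseExtension (he : Function.Injective e)
    (hf : Function.Injective f) (hed : IsDenseIn (Set.range e))
    (hec : IsCompactIn (Set.range e)) (hfc : IsCompactIn (Set.range f)) (u : C) :
    denseExtension f e (denseExtension e f u) = u := by
  conv_rhs => rw [← hed.denseExtension_self u]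
  simp only [denseExtension.eq_1 f e, denseExtension.eq_1 e e,
    sInf_image_le_denseExtension_iff e f he hf hed hec hfc]

theorem denseExtension_apply (he : Function.Injective e)
    (hec : IsCompactIn (Set.range e)) (a : A) : denseExtension e f (e a) = f a := by
  apply le_antisymm
  · simpa using denseExtension_le_sSup_image e f he hec (u := e a) (T := {a}) (by simp)
  · exact le_iSup₂_of_le {a} (by simp) (by simp)

end

/-- The canonical extension is unique up to an isomorphism fixing `A`. -/
theorem canonical_extension_unique {A : Type*} [Lattice A] [BoundedOrder A]
    {C₁ C₂ : Type*} [CompleteLattice C₁] [CompleteLattice C₂]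
    (e₁ : A → C₁) (e₂ : A → C₂)
    (h₁inj : Function.Injective e₁)
    (h₁inf : ∀ a b : A, e₁ (a ⊓ b) = e₁ a ⊓ e₁ b)
    (h₁sup : ∀ a b : A, e₁ (a ⊔ b) = e₁ a ⊔ e₁ b)
    (h₁bot : e₁ ⊥ = ⊥) (h₁top : e₁ ⊤ = ⊤)
    (h₁dense : IsDenseIn (Set.range e₁)) (h₁compact : IsCompactIn (Set.range e₁))
    (h₂inj : Function.Injective e₂)
    (h₂inf : ∀ a b : A, e₂ (a ⊓ b) = e₂ a ⊓ e₂ b)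
    (h₂sup : ∀ a b : A, e₂ (a ⊔ b) = e₂ a ⊔ e₂ b)
    (h₂bot : e₂ ⊥ = ⊥) (h₂top : e₂ ⊤ = ⊤)
    (h₂dense : IsDenseIn (Set.range e₂)) (h₂compact : IsCompactIn (Set.range e₂)) :
    ∃ φ : C₁ ≃o C₂, ∀ a : A, φ (e₁ a) = e₂ a := by
  let f₁ : BoundedLatticeHom A C₁ := ⟨⟨⟨e₁, h₁sup⟩, h₁inf⟩, h₁top, h₁bot⟩
  let f₂ : BoundedLatticeHom A C₂ := ⟨⟨⟨e₂, h₂sup⟩, h₂inf⟩, h₂top, h₂bot⟩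
  have left (u : C₁) : denseExtension e₂ e₁ (denseExtension e₁ e₂ u) = u :=
    denseExtension_denseExtension f₁ f₂ h₁inj h₂inj h₁dense h₁compact h₂compact u
  have right (v : C₂) : denseExtension e₁ e₂ (denseExtension e₂ e₁ v) = v :=
    denseExtension_denseExtension f₂ f₁ h₂inj h₁inj h₂dense h₂compact h₁compact v
  exact ⟨Equiv.toOrderIso ⟨denseExtension e₁ e₂, denseExtension e₂ e₁, left, right⟩
    (denseExtension_mono e₁ e₂) (denseExtension_mono e₂ e₁),
    denseExtension_apply f₁ f₂ h₁inj h₁compact⟩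
end

section
/- Taking the canonical extension commutes with binary products: if A₁ is a dense and compact bounded sublattice of a complete lattice C₁ and A₂ is a dense and compact bounded sublattice of a complete lattice C₂, then A₁ × A₂ is a dense and compact bounded sublattice of the complete lattice C₁ × C₂ (with componentwise order); that is, (A₁ × A₂)^δ = A₁^δ × A₂^δ. -/
theorem IsBddSublattice.prod {C₁ C₂ : Type*} [CompleteLattice C₁] [CompleteLattice C₂]
    {A₁ : Set C₁} {A₂ : Set C₂} (h₁ : IsBddSublattice A₁) (h₂ : IsBddSublattice A₂) :
    IsBddSublattice (A₁ ×ˢ A₂) :=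
  ⟨fun _ ha _ hb => ⟨h₁.1 _ ha.1 _ hb.1, h₂.1 _ ha.2 _ hb.2⟩,
    fun _ ha _ hb => ⟨h₁.2.1 _ ha.1 _ hb.1, h₂.2.1 _ ha.2 _ hb.2⟩,
    ⟨h₁.2.2.1, h₂.2.2.1⟩, ⟨h₁.2.2.2, h₂.2.2.2⟩⟩

/-- A pair of joins of meets is a join of meets in the product. Inserting `⊤` keeps the
rectangles nonempty without changing the meets. -/
theorem exists_eq_sSup_sInf_image_prod {C₁ C₂ : Type*} [CompleteLattice C₁] [CompleteLattice C₂]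
    {A₁ : Set C₁} {A₂ : Set C₂} (hbot₁ : ⊥ ∈ A₁) (htop₁ : ⊤ ∈ A₁) (hbot₂ : ⊥ ∈ A₂)
    (htop₂ : ⊤ ∈ A₂) {u₁ : C₁} {u₂ : C₂}
    (h₁ : ∃ 𝒮 : Set (Set C₁), (∀ S ∈ 𝒮, S ⊆ A₁) ∧ u₁ = sSup (sInf '' 𝒮))
    (h₂ : ∃ 𝒮 : Set (Set C₂), (∀ S ∈ 𝒮, S ⊆ A₂) ∧ u₂ = sSup (sInf '' 𝒮)) :
    ∃ 𝒮 : Set (Set (C₁ × C₂)), (∀ S ∈ 𝒮, S ⊆ A₁ ×ˢ A₂) ∧ (u₁, u₂) = sSup (sInf '' 𝒮) := by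
  obtain ⟨𝒮₁, hA₁, rfl⟩ := h₁
  obtain ⟨𝒮₂, hA₂, rfl⟩ := h₂
  have left (S : Set C₁) : sInf (insert ⊤ S ×ˢ {(⊥ : C₂)}) = (sInf S, ⊥) := by
    rw [sInf_prod (Set.insert_nonempty _ _) (Set.singleton_nonempty _)]
    simp
  have right (S : Set C₂) : sInf ({(⊥ : C₁)} ×ˢ insert ⊤ S) = (⊥, sInf S) := by
    rw [sInf_prod (Set.singleton_nonempty _) (Set.insert_nonempty _ _)]
    simp
  refine ⟨(fun S => insert ⊤ S ×ˢ {⊥}) '' 𝒮₁ ∪ (fun S => {⊥} ×ˢ insert ⊤ S) '' 𝒮₂, ?_, ?_⟩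
  · rintro _ (⟨S, hS, rfl⟩ | ⟨S, hS, rfl⟩)
    · exact Set.prod_mono (Set.insert_subset htop₁ (hA₁ S hS)) (Set.singleton_subset_iff.2 hbot₂)
    · exact Set.prod_mono (Set.singleton_subset_iff.2 hbot₁) (Set.insert_subset htop₂ (hA₂ S hS))
  · simp only [Set.image_union, Set.image_image, left, right, sSup_union, sSup_image]
    ext <;> simp [Prod.fst_iSup, Prod.snd_iSup]

theorem IsDenseIn.prod {C₁ C₂ : Type*} [CompleteLattice C₁] [CompleteLattice C₂]
    {A₁ : Set C₁} {A₂ : Set C₂} (hbot₁ : ⊥ ∈ A₁) (htop₁ : ⊤ ∈ A₁) (hbot₂ : ⊥ ∈ A₂)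
    (htop₂ : ⊤ ∈ A₂) (h₁ : IsDenseIn A₁) (h₂ : IsDenseIn A₂) : IsDenseIn (A₁ ×ˢ A₂) :=
  fun u => ⟨exists_eq_sSup_sInf_image_prod hbot₁ htop₁ hbot₂ htop₂ (h₁ u.1).1 (h₂ u.2).1,
    exists_eq_sSup_sInf_image_prod (C₁ := C₁ᵒᵈ) (C₂ := C₂ᵒᵈ) htop₁ hbot₁ htop₂ hbot₂
      (h₁ u.1).2 (h₂ u.2).2⟩

theorem IsCompactIn.prod {C₁ C₂ : Type*} [CompleteLattice C₁] [CompleteLattice C₂]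
    {A₁ : Set C₁} {A₂ : Set C₂} (h₁ : IsCompactIn A₁) (h₂ : IsCompactIn A₂) :
    IsCompactIn (A₁ ×ˢ A₂) := by
  classical
  intro S T hS hT hle
  obtain ⟨_, _, hfS, hfT, hle₁⟩ := h₁ (Prod.fst '' S) (Prod.fst '' T)
    (Set.image_subset_iff.2 fun _ hx => (hS hx).1)
    (Set.image_subset_iff.2 fun _ hx => (hT hx).1) hle.1
  obtain ⟨_, _, hsS, hsT, hle₂⟩ := h₂ (Prod.snd '' S) (Prod.snd '' T)
    (Set.image_subset_iff.2 fun _ hx => (hS hx).2)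
    (Set.image_subset_iff.2 fun _ hx => (hT hx).2) hle.2
  obtain ⟨S₁, hS₁, rfl⟩ := Finset.subset_set_image_iff.1 hfS
  obtain ⟨T₁, hT₁, rfl⟩ := Finset.subset_set_image_iff.1 hfT
  obtain ⟨S₂, hS₂, rfl⟩ := Finset.subset_set_image_iff.1 hsS
  obtain ⟨T₂, hT₂, rfl⟩ := Finset.subset_set_image_iff.1 hsT
  rw [Finset.coe_image, Finset.coe_image] at hle₁ hle₂
  refine ⟨S₁ ∪ S₂, T₁ ∪ T₂, ?_, ?_, ?_, ?_⟩
  · rw [Finset.coe_union]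
    exact Set.union_subset hS₁ hS₂
  · rw [Finset.coe_union]
    exact Set.union_subset hT₁ hT₂
  · rw [Prod.fst_sInf, Prod.fst_sSup, Finset.coe_union, Finset.coe_union]
    exact (sInf_le_sInf (Set.image_mono Set.subset_union_left)).trans
      (hle₁.trans (sSup_le_sSup (Set.image_mono Set.subset_union_left)))
  · rw [Prod.snd_sInf, Prod.snd_sSup, Finset.coe_union, Finset.coe_union]
    exact (sInf_le_sInf (Set.image_mono Set.subset_union_right)).trans
      (hle₂.trans (sSup_le_sSup (Set.image_mono Set.subset_union_right)))

/-- Canonical extension commutes with binary products: if `Aᵢ` is a dense and compact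
bounded sublattice of `Cᵢ` (`i = 1, 2`), then `A₁ × A₂` is a dense and compact bounded
sublattice of `C₁ × C₂`. -/
theorem canonical_extension_prod {C₁ C₂ : Type*} [CompleteLattice C₁] [CompleteLattice C₂]
    {A₁ : Set C₁} {A₂ : Set C₂}
    (hA₁ : IsBddSublattice A₁) (hdense₁ : IsDenseIn A₁) (hcompact₁ : IsCompactIn A₁)
    (hA₂ : IsBddSublattice A₂) (hdense₂ : IsDenseIn A₂) (hcompact₂ : IsCompactIn A₂) :
    IsBddSublattice (A₁ ×ˢ A₂) ∧ IsDenseIn (A₁ ×ˢ A₂) ∧ IsCompactIn (A₁ ×ˢ A₂) :=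
  ⟨hA₁.prod hA₂,
    hdense₁.prod hA₁.2.2.1 hA₁.2.2.2 hA₂.2.2.1 hA₂.2.2.2 hdense₂,
    hcompact₁.prod hcompact₂⟩
end

section
/- The σ-extension of a monotone map is a monotone extension: if A is a bounded sublattice of a complete lattice C and f : A → A is monotone, then f^σ : C → C is monotone and f^σ(a) = f(a) for every a ∈ A. -/
/-- The closed elements of `C` relative to `A`: meets of arbitrary subsets of `A`. -/
def closedEls {C : Type*} [CompleteLattice C] (A : Set C) : Set C :=
  {k | ∃ S ⊆ A, k = sInf S}

/-- The open elements of `C` relative to `A`: joins of arbitrary subsets of `A`. -/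
def openEls {C : Type*} [CompleteLattice C] (A : Set C) : Set C :=
  {o | ∃ S ⊆ A, o = sSup S}

/-- The σ-extension of a monotone map `f` defined on the sublattice `A`:
`f^σ(u) = ⨆ { ⨅ { f a : a ∈ A, k ≤ a } : k ∈ K(C), k ≤ u }`. -/
def sigmaExt {C : Type*} [CompleteLattice C] (A : Set C) (f : C → C) (u : C) : C :=
  sSup {v | ∃ k ∈ closedEls A, k ≤ u ∧ v = sInf (f '' {a ∈ A | k ≤ a})}

/-- The π-extension of a monotone map `f` defined on the sublattice `A`:
`f^π(u) = ⨅ { ⨆ { f a : a ∈ A, a ≤ o } : o ∈ O(C), u ≤ o }`. -/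
def piExt {C : Type*} [CompleteLattice C] (A : Set C) (f : C → C) (u : C) : C :=
  sInf {v | ∃ o ∈ openEls A, u ≤ o ∧ v = sSup (f '' {a ∈ A | a ≤ o})}

/-- The σ-extension of a monotone map `f : A → A` is a monotone map `C → C`
which agrees with `f` on `A`. -/
theorem sigmaExt_monotone_extends {C : Type*} [CompleteLattice C] {A : Set C}
    (hA : IsBddSublattice A) (f : C → C)
    (hfA : ∀ a ∈ A, f a ∈ A)
    (hmono : ∀ a ∈ A, ∀ b ∈ A, a ≤ b → f a ≤ f b) :
    Monotone (sigmaExt A f) ∧ ∀ a ∈ A, sigmaExt A f a = f a := by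
  refine ⟨fun u v huv => sSup_le_sSup ?_, fun a ha => le_antisymm (sSup_le ?_) (le_sSup ?_)⟩
  · rintro _ ⟨k, hk, hku, rfl⟩
    exact ⟨k, hk, hku.trans huv, rfl⟩
  · rintro _ ⟨k, -, hka, rfl⟩
    exact sInf_le ⟨a, ⟨ha, hka⟩, rfl⟩
  · refine ⟨a, ⟨{a}, Set.singleton_subset_iff.2 ha, sInf_singleton.symm⟩, le_rfl,
      le_antisymm (le_sInf ?_) (sInf_le ⟨a, ⟨ha, le_rfl⟩, rfl⟩)⟩
    rintro _ ⟨b, ⟨hb, hab⟩, rfl⟩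
    exact hmono a ha b hb hab
end

section
/- If A is a dense and compact bounded sublattice of a complete lattice C and f : A → A is monotone and preserves finite joins (f(⊥) = ⊥ and f(a ⊔ b) = f(a) ⊔ f(b) for all a, b ∈ A), then its σ-extension preserves arbitrary joins: f^σ(⨆U) = ⨆{ f^σ(u) : u ∈ U } for every subset U of C. -/
/-- `sigmaExt A f` is monotone, whatever `f` is. -/
theorem monotone_sigmaExt {C : Type*} [CompleteLattice C] (A : Set C) (f : C → C) :
    Monotone (sigmaExt A f) := by
  intro u v huv
  refine sSup_le_sSup ?_
  rintro _ ⟨k, hk, hku, rfl⟩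
  exact ⟨k, hk, hku.trans huv, rfl⟩

/-- By compactness, if the value of the σ-extension at `k` lies below an open element, then so
does `f a` for some `a ∈ A` above `k`. -/
theorem IsCompactIn.exists_map_le {C : Type*} [CompleteLattice C] {A : Set C}
    (hcompact : IsCompactIn A) (hA : IsBddSublattice A) {f : C → C} (hfA : ∀ a ∈ A, f a ∈ A)
    (hmono : ∀ a ∈ A, ∀ b ∈ A, a ≤ b → f a ≤ f b) {k : C} {T : Set C} (hT : T ⊆ A)
    (h : sInf (f '' {a ∈ A | k ≤ a}) ≤ sSup T) :
    ∃ a ∈ A, k ≤ a ∧ f a ≤ sSup T := by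
  have hfS : f '' {a ∈ A | k ≤ a} ⊆ A := by
    rintro _ ⟨a, ha, rfl⟩
    exact hfA a ha.1
  obtain ⟨S', T', hS', hT', hle⟩ := hcompact _ _ hfS hT h
  have hmem : S'.inf id ∈ {b | ∃ a ∈ A, k ≤ a ∧ f a ≤ b} := by
    refine Finset.inf_mem {b | ∃ a ∈ A, k ≤ a ∧ f a ≤ b} ⟨⊤, hA.2.2.2, le_top, le_top⟩ ?_ _ _ ?_
    · rintro x ⟨a, ha, hka, hax⟩ y ⟨b, hb, hkb, hby⟩
      have hab := hA.1 a ha b hb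
      exact ⟨a ⊓ b, hab, le_inf hka hkb, le_inf
        ((hmono _ hab _ ha inf_le_left).trans hax) ((hmono _ hab _ hb inf_le_right).trans hby)⟩
    · intro x hx
      obtain ⟨a, ⟨ha, hka⟩, rfl⟩ := hS' hx
      exact ⟨a, ha, hka, le_rfl⟩
  obtain ⟨a, ha, hka, hfa⟩ := hmem
  rw [Finset.inf_id_eq_sInf] at hfa
  exact ⟨a, ha, hka, hfa.trans (hle.trans (sSup_le_sSup hT'))⟩

/-- By compactness, a closed element below the join of a subset `I` of `A` that is closed under
finite joins lies below an element of `I`. -/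
theorem IsCompactIn.exists_mem_ge {C : Type*} [CompleteLattice C] {A I : Set C}
    (hcompact : IsCompactIn A) (hI : I ⊆ A) (hbot : ⊥ ∈ I)
    (hsup : ∀ a ∈ I, ∀ b ∈ I, a ⊔ b ∈ I) {k : C} (hk : k ∈ closedEls A) (h : k ≤ sSup I) :
    ∃ a ∈ I, k ≤ a := by
  obtain ⟨S, hS, rfl⟩ := hk
  obtain ⟨S', T', hS', hT', hle⟩ := hcompact _ _ hS hI h
  refine ⟨sSup (T' : Set C), ?_, (sInf_le_sInf hS').trans hle⟩
  rw [← Finset.sup_id_eq_sSup]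
  exact Finset.sup_mem I hbot hsup _ _ fun x hx => hT' hx

/-- If the monotone `f : A → A` preserves finite joins, then its σ-extension preserves
arbitrary joins. -/
theorem sigmaExt_preserves_sSup {C : Type*} [CompleteLattice C] {A : Set C}
    (hA : IsBddSublattice A) (hdense : IsDenseIn A) (hcompact : IsCompactIn A)
    (f : C → C) (hfA : ∀ a ∈ A, f a ∈ A)
    (hmono : ∀ a ∈ A, ∀ b ∈ A, a ≤ b → f a ≤ f b)
    (hbot : f ⊥ = ⊥)
    (hsup : ∀ a ∈ A, ∀ b ∈ A, f (a ⊔ b) = f a ⊔ f b) :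
    ∀ U : Set C, sigmaExt A f (sSup U) = sSup (sigmaExt A f '' U) := by
  intro U
  apply le_antisymm
  · obtain ⟨𝒯, h𝒯, hc⟩ := (hdense (sSup (sigmaExt A f '' U))).2
    rw [hc]
    refine le_sInf ?_
    rintro _ ⟨T, hT, rfl⟩
    have hcT : sSup (sigmaExt A f '' U) ≤ sSup T := hc.trans_le (sInf_le ⟨T, hT, rfl⟩)
    let I : Set C := {a ∈ A | f a ≤ sSup T}
    have hU : sSup U ≤ sSup I := by
      refine sSup_le fun u hu => ?_
      obtain ⟨𝒮, h𝒮, hu𝒮⟩ := (hdense u).1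
      rw [hu𝒮]
      refine sSup_le ?_
      rintro _ ⟨S, hS, rfl⟩
      have hSu : sInf S ≤ u := hu𝒮 ▸ le_sSup (Set.mem_image_of_mem sInf hS)
      have hle : sInf (f '' {a ∈ A | sInf S ≤ a}) ≤ sSup T :=
        (le_sSup ⟨sInf S, ⟨S, h𝒮 S hS, rfl⟩, hSu, rfl⟩ : _ ≤ sigmaExt A f u).trans
          ((le_sSup (Set.mem_image_of_mem _ hu)).trans hcT)
      obtain ⟨a, ha, hSa, hfa⟩ := hcompact.exists_map_le hA hfA hmono (h𝒯 T hT) hle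
      exact hSa.trans (le_sSup ⟨ha, hfa⟩)
    refine sSup_le ?_
    rintro _ ⟨k, hk, hkU, rfl⟩
    obtain ⟨a, ⟨ha, hfa⟩, hka⟩ := hcompact.exists_mem_ge (I := I) (fun _ h => h.1)
      ⟨hA.2.2.1, hbot.trans_le bot_le⟩
      (fun a ha b hb => ⟨hA.2.1 a ha.1 b hb.1,
        (hsup a ha.1 b hb.1).trans_le (sup_le ha.2 hb.2)⟩) hk (hkU.trans hU)
    exact sInf_le_of_le ⟨a, ⟨ha, hka⟩, rfl⟩ hfa
  · refine sSup_le ?_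
    rintro _ ⟨u, hu, rfl⟩
    exact monotone_sigmaExt A f (le_sSup hu)
end

section
/- If A is a dense and compact bounded sublattice of a complete lattice C and g : A → A is monotone and preserves finite meets (g(⊤) = ⊤ and g(a ⊓ b) = g(a) ⊓ g(b) for all a, b ∈ A), then its π-extension preserves arbitrary meets: g^π(⨅U) = ⨅{ g^π(u) : u ∈ U } for every subset U of C. -/
section LeftAdjoint

variable {C : Type*} [CompleteLattice C] {A : Set C} {g : C → C}

/-- The left adjoint, on closed elements, of the π-extension of `g`. -/
def piExtLeftAdjoint (A : Set C) (g : C → C) (k : C) : C :=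
  sInf {a ∈ A | k ≤ g a}

theorem sInf_finset_mem_and_le_map (hA : IsBddSublattice A) (htop : g ⊤ = ⊤)
    (hinf : ∀ a ∈ A, ∀ b ∈ A, g (a ⊓ b) = g a ⊓ g b) {k : C} (s : Finset C)
    (hs : (s : Set C) ⊆ {a ∈ A | k ≤ g a}) :
    sInf (s : Set C) ∈ A ∧ k ≤ g (sInf (s : Set C)) := by
  classical
  induction s using Finset.induction_on with
  | empty => simpa [htop] using hA.2.2.2
  | insert a s _ ih =>
    rw [Finset.coe_insert, Set.insert_subset_iff] at hs
    obtain ⟨ha, hs⟩ := hs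
    obtain ⟨hmem, hle⟩ := ih hs
    rw [Finset.coe_insert, sInf_insert, hinf a ha.1 _ hmem]
    exact ⟨hA.1 a ha.1 _ hmem, le_inf ha.2 hle⟩

theorem exists_sSup_finset_le_map (hA : IsBddSublattice A)
    (hmono : ∀ a ∈ A, ∀ b ∈ A, a ≤ b → g a ≤ g b) {o : C} (t : Finset C)
    (ht : (t : Set C) ⊆ g '' {a ∈ A | a ≤ o}) :
    ∃ b ∈ A, b ≤ o ∧ sSup (t : Set C) ≤ g b := by
  classical
  induction t using Finset.induction_on with
  | empty => exact ⟨⊥, hA.2.2.1, bot_le, by simp⟩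
  | insert c t _ ih =>
    rw [Finset.coe_insert, Set.insert_subset_iff] at ht
    obtain ⟨⟨a, ⟨haA, hao⟩, rfl⟩, ht⟩ := ht
    obtain ⟨b, hbA, hbo, hb⟩ := ih ht
    have hab := hA.2.1 a haA b hbA
    refine ⟨a ⊔ b, hab, sup_le hao hbo, ?_⟩
    rw [Finset.coe_insert, sSup_insert]
    exact sup_le (hmono a haA _ hab le_sup_left) (hb.trans (hmono b hbA _ hab le_sup_right))

theorem le_sSup_map_iff_piExtLeftAdjoint_le (hA : IsBddSublattice A) (hcompact : IsCompactIn A)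
    (hgA : ∀ a ∈ A, g a ∈ A) (hmono : ∀ a ∈ A, ∀ b ∈ A, a ≤ b → g a ≤ g b)
    (htop : g ⊤ = ⊤) (hinf : ∀ a ∈ A, ∀ b ∈ A, g (a ⊓ b) = g a ⊓ g b)
    {k o : C} (hk : k ∈ closedEls A) (ho : o ∈ openEls A) :
    k ≤ sSup (g '' {a ∈ A | a ≤ o}) ↔ piExtLeftAdjoint A g k ≤ o := by
  constructor
  · intro h
    obtain ⟨S, hS, rfl⟩ := hk
    obtain ⟨s, t, hs, ht, hst⟩ := hcompact S _ hS
      (by rintro _ ⟨a, ha, rfl⟩; exact hgA a ha.1) h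
    obtain ⟨b, hbA, hbo, hb⟩ := exists_sSup_finset_le_map hA hmono t ht
    have hkb : sInf S ≤ g b := (sInf_le_sInf hs).trans (hst.trans hb)
    exact (sInf_le ⟨hbA, hkb⟩ : piExtLeftAdjoint A g (sInf S) ≤ b).trans hbo
  · intro h
    obtain ⟨T, hT, rfl⟩ := ho
    obtain ⟨s, t, hs, ht, hst⟩ := hcompact _ T (fun a ha => ha.1) hT h
    obtain ⟨hmem, hle⟩ := sInf_finset_mem_and_le_map hA htop hinf s hs
    exact hle.trans (le_sSup ⟨_, ⟨hmem, hst.trans (sSup_le_sSup ht)⟩, rfl⟩)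

theorem IsDenseIn.le_of_forall_openEls (hdense : IsDenseIn A) {x u : C}
    (h : ∀ o ∈ openEls A, u ≤ o → x ≤ o) : x ≤ u := by
  obtain ⟨-, 𝒯, h𝒯, hu⟩ := hdense u
  rw [hu]
  refine le_sInf ?_
  rintro _ ⟨T, hT, rfl⟩
  exact h _ ⟨T, h𝒯 T hT, rfl⟩ (hu.trans_le (sInf_le ⟨T, hT, rfl⟩))

theorem IsDenseIn.le_of_forall_closedEls (hdense : IsDenseIn A) {x u : C}
    (h : ∀ k ∈ closedEls A, k ≤ u → k ≤ x) : u ≤ x := by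
  obtain ⟨⟨𝒮, h𝒮, hu⟩, -⟩ := hdense u
  rw [hu]
  refine sSup_le ?_
  rintro _ ⟨S, hS, rfl⟩
  exact h _ ⟨S, h𝒮 S hS, rfl⟩ ((le_sSup (Set.mem_image_of_mem sInf hS)).trans_eq hu.symm)

theorem le_piExt_iff_piExtLeftAdjoint_le (hA : IsBddSublattice A) (hdense : IsDenseIn A)
    (hcompact : IsCompactIn A) (hgA : ∀ a ∈ A, g a ∈ A)
    (hmono : ∀ a ∈ A, ∀ b ∈ A, a ≤ b → g a ≤ g b)
    (htop : g ⊤ = ⊤) (hinf : ∀ a ∈ A, ∀ b ∈ A, g (a ⊓ b) = g a ⊓ g b)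
    {k : C} (hk : k ∈ closedEls A) (u : C) :
    k ≤ piExt A g u ↔ piExtLeftAdjoint A g k ≤ u := by
  have key {o : C} (ho : o ∈ openEls A) :=
    le_sSup_map_iff_piExtLeftAdjoint_le hA hcompact hgA hmono htop hinf hk ho
  constructor
  · intro h
    exact hdense.le_of_forall_openEls fun o ho huo =>
      (key ho).1 (h.trans (sInf_le ⟨o, ho, huo, rfl⟩))
  · intro h
    refine le_sInf ?_
    rintro _ ⟨o, ho, huo, rfl⟩
    exact (key ho).2 (h.trans huo)

end LeftAdjoint

/-- If the monotone `g : A → A` preserves finite meets, then its π-extension preserves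
arbitrary meets. -/
theorem piExt_preserves_sInf {C : Type*} [CompleteLattice C] {A : Set C}
    (hA : IsBddSublattice A) (hdense : IsDenseIn A) (hcompact : IsCompactIn A)
    (g : C → C) (hgA : ∀ a ∈ A, g a ∈ A)
    (hmono : ∀ a ∈ A, ∀ b ∈ A, a ≤ b → g a ≤ g b)
    (htop : g ⊤ = ⊤)
    (hinf : ∀ a ∈ A, ∀ b ∈ A, g (a ⊓ b) = g a ⊓ g b) :
    ∀ U : Set C, piExt A g (sInf U) = sInf (piExt A g '' U) := by
  intro U
  have adj {k : C} (hk : k ∈ closedEls A) (u : C) :=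
    le_piExt_iff_piExtLeftAdjoint_le hA hdense hcompact hgA hmono htop hinf hk u
  have same {k : C} (hk : k ∈ closedEls A) :
      k ≤ piExt A g (sInf U) ↔ k ≤ sInf (piExt A g '' U) := by
    simp only [adj hk, le_sInf_iff, Set.forall_mem_image]
  exact le_antisymm (hdense.le_of_forall_closedEls fun k hk => (same hk).1)
    (hdense.le_of_forall_closedEls fun k hk => (same hk).2)
end

section
/- Soundness of the Right Ackermann rule (RA): let L be a complete lattice, (αᵢ)_{i ∈ I} a family of elements of L, and for each j in an index set J let βⱼ : L → L be monotone and γⱼ : L → L be antitone. Then there exists p ∈ L with αᵢ ≤ p for all i ∈ I and βⱼ(p) ≤ γⱼ(p) for all j ∈ J, if and only if βⱼ(⨆ᵢ αᵢ) ≤ γⱼ(⨆ᵢ αᵢ) for all j ∈ J. -/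
/-- Soundness of the Right Ackermann rule (RA): in a complete lattice, there is a `p`
above all the `αᵢ` with `βⱼ p ≤ γⱼ p` for all `j` (with each `βⱼ` monotone and each
`γⱼ` antitone) iff `βⱼ (⨆ i, α i) ≤ γⱼ (⨆ i, α i)` for all `j`. -/
theorem right_ackermann_rule {L : Type*} [CompleteLattice L] {I J : Type*}
    (α : I → L) (β γ : J → L → L)
    (hβ : ∀ j, Monotone (β j)) (hγ : ∀ j, Antitone (γ j)) :
    (∃ p : L, (∀ i, α i ≤ p) ∧ ∀ j, β j p ≤ γ j p) ↔
      ∀ j, β j (⨆ i, α i) ≤ γ j (⨆ i, α i) := by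
  constructor
  · rintro ⟨p, hα, hp⟩ j
    have hle : ⨆ i, α i ≤ p := iSup_le hα
    exact (hβ j hle).trans ((hp j).trans (hγ j hle))
  · exact fun h => ⟨⨆ i, α i, le_iSup α, h⟩
end

section
/- Soundness of the Left Ackermann rule (LA): let L be a complete lattice, (αᵢ)_{i ∈ I} a family of elements of L, and for each j in an index set J let βⱼ : L → L be monotone and γⱼ : L → L be antitone. Then there exists p ∈ L with p ≤ αᵢ for all i ∈ I and γⱼ(p) ≤ βⱼ(p) for all j ∈ J, if and only if γⱼ(⨅ᵢ αᵢ) ≤ βⱼ(⨅ᵢ αᵢ) for all j ∈ J. -/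
/-- Soundness of the Left Ackermann rule (LA): in a complete lattice, there is a `p`
below all the `αᵢ` with `γⱼ p ≤ βⱼ p` for all `j` (with each `βⱼ` monotone and each
`γⱼ` antitone) iff `γⱼ (⨅ i, α i) ≤ βⱼ (⨅ i, α i)` for all `j`. -/
theorem left_ackermann_rule {L : Type*} [CompleteLattice L] {I J : Type*}
    (α : I → L) (β γ : J → L → L)
    (hβ : ∀ j, Monotone (β j)) (hγ : ∀ j, Antitone (γ j)) :
    (∃ p : L, (∀ i, p ≤ α i) ∧ ∀ j, γ j p ≤ β j p) ↔
      ∀ j, γ j (⨅ i, α i) ≤ β j (⨅ i, α i) := by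
  constructor
  · rintro ⟨p, hp, h⟩ j
    have hle : p ≤ ⨅ i, α i := le_iInf hp
    exact (hγ j hle).trans ((h j).trans (hβ j hle))
  · exact fun h => ⟨⨅ i, α i, iInf_le α, h⟩
end
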